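/- Bounds (4.11) and (4.12) of Lemma 4.6 on the tree operators ℒ̄^L and ℒ̃^L: Let L ≥ 1 and m ≥ 1 be integers. Let f : ℝ^m → ℝ and g : ℝ^m → ℝ^m be (L+1) times continuously differentiable with sup_{y} ‖∂^τ f(y)‖ ≤ C^0 and sup_{y} ‖∂^τ g(y)‖ ≤ C^0 for every 0 ≤ τ ≤ L+1. For each 0 ≤ ℓ ≤ L let c_{ℓ,i} ≥ 0 be real constants indexed by i ∈ A_ℓ, let y ∈ ℝ^m, let ξ^1, …, ξ^L ∈ ℝ^m, set a_ℓ = ‖ξ^ℓ‖ and P^ℓ = P^ℓ(a), and define ℒ^ℓ g(y) = ∑_{i ∈ A_ℓ} c_{ℓ,i} · ∂^{ℓ_1^i} g(y)[ξ^{ℓ_2^i}, …, ξ^{ℓ_{α_i}^i}] ∈ ℝ^m for ℓ ≥ 1 and ℒ^0 g(y) = g(y). Set C^1_ℓ = (∑_{i ∈ A_ℓ} c_{ℓ,i})·C^0 for ℓ ≥ 1 and C^1_0 = C^0. Define ℒ̄^L(∂f·g)(y) = ∑_{i ∈ A_L} c_{L,i}·∂^{ℓ_1^i + 1} f(y)[ξ^{ℓ_2^i},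 …, ξ^{ℓ_{α_i}^i}, g(y)] + ∑_{i ∈ A_L} ∑_{r=2}^{α_i} c_{L,i}·∂^{ℓ_1^i} f(y)[ξ^{ℓ_2^i}, …, ℒ^{ℓ_r^i} g(y), …, ξ^{ℓ_{α_i}^i}] (the r-th slot replaced by ℒ^{ℓ_r^i} g(y)), and ℒ̃^L(∂f·g)(y) = ∑_{i ∈ A_L} ∑_{r=2}^{α_i} c_{L,i}·∂^{ℓ_1^i} f(y)[ξ^{ℓ_2^i}, …, ℒ^{ℓ_r^i − 1} g(y), …, ξ^{ℓ_{α_i}^i}]. Then |ℒ̄^L(∂f·g)(y)| ≤ C^2_L · P^L with C^2_L = ∑_{i ∈ A_L} c_{L,i}·C^0·(C^0 + ∑_{r=2}^{α_i} C^1_{ℓ_r^i}), and |ℒ̃^L(∂f·g)(y)| ≤ C^3_L · P^L with C^3_L = ∑_{i ∈ A_L} ∑_{r=2}^{α_i} c_{L,i}·C^0·C^1_{ℓ_r^i − 1}. -/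

import Mathlib

/-- A branch of length `N`: a sequence `i_1, …, i_N` of positive integers (encoded as a
function `ℕ → ℕ` vanishing outside `{1, …, N}`) such that `i_1 = 1` and, for every
`1 ≤ τ < N`, `i_{τ+1} ≤ 1 + #{σ ∈ {1,…,τ} : i_σ = 1}`.  `A_N` is the set of branches of
length `N`. -/
def IsBranch (N : ℕ) (i : ℕ → ℕ) : Prop :=
  i 1 = 1 ∧
  (∀ τ, 1 ≤ τ → τ ≤ N → 1 ≤ i τ) ∧
  (∀ τ, 1 ≤ τ → τ < N →
    i (τ + 1) ≤ 1 + ((Finset.Icc 1 τ).filter (fun σ => i σ = 1)).card) ∧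
  (∀ τ, τ = 0 ∨ N < τ → i τ = 0)

/-- `ell N i r = ℓ_r^i`: for `r = 1` the number of `1`'s in the branch `i` of length `N`,
and for `r ≥ 2` one plus the number of `r`'s in `i`. -/
def ell (N : ℕ) (i : ℕ → ℕ) (r : ℕ) : ℕ :=
  if r = 1 then ((Finset.Icc 1 N).filter (fun τ => i τ = 1)).card
  else 1 + ((Finset.Icc 1 N).filter (fun τ => i τ = r)).card

/-- `alpha N i = α_i = ℓ_1^i + 1`. -/
def alpha (N : ℕ) (i : ℕ → ℕ) : ℕ := ell N i 1 + 1

/-- `Pmax a L = P^L(a)`: the maximum of `1` and of all products `a_{q_1} ⋯ a_{q_k}` over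
nonempty tuples `(q_1, …, q_k)` of positive integers with `q_1 + ⋯ + q_k ≤ L`. -/
noncomputable def Pmax (a : ℕ → ℝ) (L : ℕ) : ℝ :=
  sSup (insert (1 : ℝ)
    {x : ℝ | ∃ l : List ℕ, l ≠ [] ∧ (∀ q ∈ l, 1 ≤ q) ∧ l.sum ≤ L ∧ x = (l.map a).prod})

/-- The tree operator `ℒ^ℓ g(y) = ∑_{i ∈ A_ℓ} c_{ℓ,i} · ∂^{ℓ_1^i} g(y)[ξ^{ℓ_2^i}, …, ξ^{ℓ_{α_i}^i}]`
for `ℓ ≥ 1`, together with the convention `ℒ^0 g(y) = g(y)`. -/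
noncomputable def Lop (m : ℕ) (c : ℕ → (ℕ → ℕ) → ℝ)
    (g : (Fin m → ℝ) → Fin m → ℝ) (ξ : ℕ → Fin m → ℝ) (y : Fin m → ℝ)
    (ℓ : ℕ) : Fin m → ℝ :=
  if ℓ = 0 then g y
  else ∑ᶠ i ∈ {i : ℕ → ℕ | IsBranch ℓ i},
    c ℓ i • iteratedFDeriv ℝ (ell ℓ i 1) g y
      (fun j : Fin (ell ℓ i 1) => ξ (ell ℓ i ((j : ℕ) + 2)))

/-- `ℒ̄^L(∂f·g)(y) = ∑_{i ∈ A_L} c_{L,i}·∂^{ℓ_1^i+1} f(y)[ξ^{ℓ_2^i}, …, ξ^{ℓ_{α_i}^i}, g(y)]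
+ ∑_{i ∈ A_L} ∑_{r=2}^{α_i} c_{L,i}·∂^{ℓ_1^i} f(y)[ξ^{ℓ_2^i}, …, ℒ^{ℓ_r^i} g(y), …, ξ^{ℓ_{α_i}^i}]`
(the `r`-th slot replaced by `ℒ^{ℓ_r^i} g(y)`). -/
noncomputable def barL (m : ℕ) (c : ℕ → (ℕ → ℕ) → ℝ)
    (f : (Fin m → ℝ) → ℝ) (g : (Fin m → ℝ) → Fin m → ℝ)
    (ξ : ℕ → Fin m → ℝ) (y : Fin m → ℝ) (L : ℕ) : ℝ :=
  (∑ᶠ i ∈ {i : ℕ → ℕ | IsBranch L i},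
    c L i * iteratedFDeriv ℝ (ell L i 1 + 1) f y
      (fun j : Fin (ell L i 1 + 1) =>
        if (j : ℕ) < ell L i 1 then ξ (ell L i ((j : ℕ) + 2)) else g y)) +
  ∑ᶠ i ∈ {i : ℕ → ℕ | IsBranch L i},
    ∑ r ∈ Finset.Icc 2 (alpha L i),
      c L i * iteratedFDeriv ℝ (ell L i 1) f y
        (fun j : Fin (ell L i 1) =>
          if (j : ℕ) + 2 = r then Lop m c g ξ y (ell L i r)
          else ξ (ell L i ((j : ℕ) + 2)))

/-- `ℒ̃^L(∂f·g)(y) = ∑_{i ∈ A_L} ∑_{r=2}^{α_i} c_{L,i}·∂^{ℓ_1^i} f(y)[ξ^{ℓ_2^i}, …,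
ℒ^{ℓ_r^i − 1} g(y), …, ξ^{ℓ_{α_i}^i}]` (the `r`-th slot replaced by `ℒ^{ℓ_r^i−1} g(y)`). -/
noncomputable def tildeL (m : ℕ) (c : ℕ → (ℕ → ℕ) → ℝ)
    (f : (Fin m → ℝ) → ℝ) (g : (Fin m → ℝ) → Fin m → ℝ)
    (ξ : ℕ → Fin m → ℝ) (y : Fin m → ℝ) (L : ℕ) : ℝ :=
  ∑ᶠ i ∈ {i : ℕ → ℕ | IsBranch L i},
    ∑ r ∈ Finset.Icc 2 (alpha L i),
      c L i * iteratedFDeriv ℝ (ell L i 1) f y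
        (fun j : Fin (ell L i 1) =>
          if (j : ℕ) + 2 = r then Lop m c g ξ y (ell L i r - 1)
          else ξ (ell L i ((j : ℕ) + 2)))

/-- `C^1_ℓ = (∑_{i ∈ A_ℓ} c_{ℓ,i})·C⁰` for `ℓ ≥ 1` and `C^1_0 = C⁰`. -/
noncomputable def Cone (c : ℕ → (ℕ → ℕ) → ℝ) (C0 : ℝ) (ℓ : ℕ) : ℝ :=
  if ℓ = 0 then C0 else (∑ᶠ i ∈ {i : ℕ → ℕ | IsBranch ℓ i}, c ℓ i) * C0

theorem Pmax_set_bddAbove (a : ℕ → ℝ) (ha : ∀ q, 0 ≤ a q) (L : ℕ) :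
    BddAbove (insert (1 : ℝ)
      {x : ℝ | ∃ l : List ℕ, l ≠ [] ∧ (∀ q ∈ l, 1 ≤ q) ∧ l.sum ≤ L ∧ x = (l.map a).prod}) := by
  have hM1 : (1 : ℝ) ≤ 1 + ∑ q ∈ Finset.range (L + 1), a q := by
    have := Finset.sum_nonneg (s := Finset.range (L + 1)) (fun q _ => ha q)
    linarith
  have hMa : ∀ q ≤ L, a q ≤ 1 + ∑ q ∈ Finset.range (L + 1), a q := by
    intro q hq
    have := Finset.single_le_sum (f := a) (s := Finset.range (L + 1)) (fun q _ => ha q)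
      (Finset.mem_range.2 (Nat.lt_succ_of_le hq))
    linarith
  generalize 1 + ∑ q ∈ Finset.range (L + 1), a q = M at hM1 hMa
  have key : ∀ l : List ℕ, (∀ q ∈ l, 1 ≤ q) → l.sum ≤ L → (l.map a).prod ≤ M ^ l.sum := by
    intro l
    induction l with
    | nil => simp
    | cons q l ih =>
      intro h1 h2
      simp only [List.mem_cons, forall_eq_or_imp, List.sum_cons] at h1 h2
      rw [List.map_cons, List.prod_cons, List.sum_cons, pow_add]
      refine mul_le_mul ((hMa q (by omega)).trans (le_self_pow₀ hM1 (by omega)))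
        (ih h1.2 (by omega)) (List.prod_nonneg ?_) (by positivity)
      simp only [List.mem_map]
      rintro _ ⟨q, -, rfl⟩
      exact ha q
  refine ⟨M ^ L, ?_⟩
  rintro x (rfl | ⟨l, -, h1, h2, rfl⟩)
  · exact one_le_pow₀ hM1
  · exact (key l h1 h2).trans (pow_le_pow_right₀ hM1 h2)

theorem list_prod_le_Pmax (a : ℕ → ℝ) (ha : ∀ q, 0 ≤ a q) (L : ℕ) (l : List ℕ)
    (h1 : ∀ q ∈ l, 1 ≤ q) (h2 : l.sum ≤ L) : (l.map a).prod ≤ Pmax a L := by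
  refine le_csSup (Pmax_set_bddAbove a ha L) ?_
  by_cases h : l = []
  · left; simp [h]
  · right; exact ⟨l, h, h1, h2, rfl⟩

theorem one_le_Pmax (a : ℕ → ℝ) (ha : ∀ q, 0 ≤ a q) (L : ℕ) : 1 ≤ Pmax a L := by
  simpa using list_prod_le_Pmax a ha L [] (by simp) (by simp)

theorem list_prod_mul_Pmax_le (a : ℕ → ℝ) (ha : ∀ q, 0 ≤ a q) (k L : ℕ) (l : List ℕ)
    (h1 : ∀ q ∈ l, 1 ≤ q) (h2 : l.sum + k ≤ L) : (l.map a).prod * Pmax a k ≤ Pmax a L := by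
  have h0 : 0 ≤ (l.map a).prod := by
    refine List.prod_nonneg ?_
    simp only [List.mem_map]
    rintro _ ⟨q, -, rfl⟩
    exact ha q
  rcases h0.eq_or_lt with h0 | h0
  · rw [← h0, zero_mul]
    exact zero_le_one.trans (one_le_Pmax a ha L)
  · rw [mul_comm, ← le_div_iff₀ h0]
    refine csSup_le ⟨1, Or.inl rfl⟩ ?_
    rintro x (rfl | ⟨l', -, h1', h2', rfl⟩)
    · rw [le_div_iff₀ h0, one_mul]
      exact list_prod_le_Pmax a ha L l h1 (by omega)
    · rw [le_div_iff₀ h0, ← List.prod_append, ← List.map_append]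
      refine list_prod_le_Pmax a ha L _ ?_ (by rw [List.sum_append]; omega)
      intro q hq
      rcases List.mem_append.1 hq with h | h
      · exact h1' q h
      · exact h1 q h

theorem prod_mul_Pmax_le {ι : Type*} (a : ℕ → ℝ) (ha : ∀ q, 0 ≤ a q) (k L : ℕ) (s : Finset ι)
    (q : ι → ℕ) (h1 : ∀ j ∈ s, 1 ≤ q j) (h2 : ∑ j ∈ s, q j + k ≤ L) :
    (∏ j ∈ s, a (q j)) * Pmax a k ≤ Pmax a L := by
  have h := list_prod_mul_Pmax_le a ha k L (s.toList.map q) (by simpa using h1)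
    (by rwa [Finset.sum_map_toList])
  rwa [List.map_map, Finset.prod_map_toList] at h

theorem prod_le_Pmax {ι : Type*} (a : ℕ → ℝ) (ha : ∀ q, 0 ≤ a q) (L : ℕ) (s : Finset ι)
    (q : ι → ℕ) (h1 : ∀ j ∈ s, 1 ≤ q j) (h2 : ∑ j ∈ s, q j ≤ L) :
    ∏ j ∈ s, a (q j) ≤ Pmax a L :=
  (le_mul_of_one_le_right (Finset.prod_nonneg fun j _ => ha (q j)) (one_le_Pmax a ha 0)).trans
    (prod_mul_Pmax_le a ha 0 L s q h1 h2)

theorem one_le_ell_add_two (N : ℕ) (i : ℕ → ℕ) (j : ℕ) : 1 ≤ ell N i (j + 2) := by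
  simp [ell]

theorem ell_one_le (N : ℕ) (i : ℕ → ℕ) : ell N i 1 ≤ N := by
  simpa [ell] using Finset.card_filter_le (Finset.Icc 1 N) (fun τ => i τ = 1)

theorem sum_ell_le (N : ℕ) (i : ℕ → ℕ) : ∑ j : Fin (ell N i 1), ell N i (j + 2) ≤ N := by
  have h1 : ∑ j : Fin (ell N i 1), ell N i (j + 2) = ell N i 1 +
      ∑ j ∈ Finset.range (ell N i 1), ((Finset.Icc 1 N).filter (fun τ => i τ = j + 2)).card := by
    rw [Fin.sum_univ_eq_sum_range (fun j => ell N i (j + 2))]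
    simp [ell, Finset.sum_add_distrib]
  have h2 : ∑ j ∈ Finset.range (ell N i 1), ((Finset.Icc 1 N).filter (fun τ => i τ = j + 2)).card
      ≤ ((Finset.Icc 1 N).filter (fun τ => ¬ i τ = 1)).card := by
    rw [← Finset.card_biUnion]
    · refine Finset.card_le_card fun τ => ?_
      simp only [Finset.mem_biUnion, Finset.mem_filter]
      rintro ⟨j, -, h, h'⟩
      exact ⟨h, by omega⟩
    · intro j _ j' _ hjj
      rw [Function.onFun, Finset.disjoint_filter]
      intro τ _ h h'
      omega
  have h3 := Finset.card_filter_add_card_filter_not (s := Finset.Icc 1 N) (fun τ => i τ = 1)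
  have h4 : ell N i 1 = ((Finset.Icc 1 N).filter (fun τ => i τ = 1)).card := by simp [ell]
  rw [Nat.card_Icc] at h3
  omega

theorem finite_setOf_isBranch (N : ℕ) : {i : ℕ → ℕ | IsBranch N i}.Finite := by
  refine Set.Finite.of_injOn (f := fun i (t : Fin (N + 1)) => i t)
    (t := {x | ∀ t, x t ∈ Set.Iic (N + 1)}) ?_ ?_ (Set.Finite.pi' fun _ => Set.finite_Iic _)
  · rintro i ⟨h1, -, h3, h4⟩ ⟨t, ht⟩
    simp only [Set.mem_Iic]
    match t, ht with
    | 0, _ => simp [h4 0 (Or.inl rfl)]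
    | 1, _ => omega
    | t + 2, ht =>
      have h := h3 (t + 1) (by omega) (by omega)
      have h' := Finset.card_filter_le (Finset.Icc 1 (t + 1)) (fun σ => i σ = 1)
      rw [Nat.card_Icc] at h'
      show i (t + 1 + 1) ≤ _
      omega
  · rintro i ⟨-, -, -, hi⟩ i' ⟨-, -, -, hi'⟩ h
    funext t
    by_cases ht : t < N + 1
    · exact congrFun h ⟨t, ht⟩
    · rw [hi t (by omega), hi' t (by omega)]

theorem norm_finsum_mem_le_mul {ι E : Type*} [SeminormedAddCommGroup E] {S : Set ι}
    (hS : S.Finite) (F : ι → E) (G : ι → ℝ) (P : ℝ) (h : ∀ i ∈ S, ‖F i‖ ≤ G i * P) :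
    ‖∑ᶠ i ∈ S, F i‖ ≤ (∑ᶠ i ∈ S, G i) * P := by
  rw [finsum_mem_eq_finite_toFinset_sum _ hS, finsum_mem_eq_finite_toFinset_sum _ hS,
    Finset.sum_mul]
  exact norm_sum_le_of_le _ fun i hi => h i (hS.mem_toFinset.1 hi)

theorem norm_iteratedFDeriv_apply_le {E F : Type*} [NormedAddCommGroup E] [NormedSpace ℝ E]
    [NormedAddCommGroup F] [NormedSpace ℝ F] {f : E → F} {y : E} {n : ℕ} {C0 : ℝ}
    (hC : ‖iteratedFDeriv ℝ n f y‖ ≤ C0) (v : Fin n → E) :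
    ‖iteratedFDeriv ℝ n f y v‖ ≤ C0 * ∏ j, ‖v j‖ :=
  ((iteratedFDeriv ℝ n f y).le_opNorm v).trans
    (mul_le_mul_of_nonneg_right hC (Finset.prod_nonneg fun _ _ => norm_nonneg _))

theorem norm_Lop_le {m : ℕ} (c : ℕ → (ℕ → ℕ) → ℝ) (g : (Fin m → ℝ) → Fin m → ℝ)
    (ξ : ℕ → Fin m → ℝ) (y : Fin m → ℝ) (C0 : ℝ) (k : ℕ)
    (hCg : ∀ τ ≤ k, ‖iteratedFDeriv ℝ τ g y‖ ≤ C0) (hc : ∀ i, IsBranch k i → 0 ≤ c k i) :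
    ‖Lop m c g ξ y k‖ ≤ Cone c C0 k * Pmax (fun q => ‖ξ q‖) k := by
  have ha : ∀ q, 0 ≤ (fun q => ‖ξ q‖) q := fun q => norm_nonneg _
  have hC0 : 0 ≤ C0 := (norm_nonneg _).trans (hCg 0 (Nat.zero_le _))
  unfold Lop Cone
  split_ifs with hk
  · have := hCg 0 (Nat.zero_le _)
    rw [norm_iteratedFDeriv_zero] at this
    exact this.trans (le_mul_of_one_le_right hC0 (one_le_Pmax _ ha k))
  · rw [mul_assoc]
    refine norm_finsum_mem_le_mul (finite_setOf_isBranch k) _ _ _ fun i hi => ?_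
    rw [norm_smul, Real.norm_of_nonneg (hc i hi)]
    refine mul_le_mul_of_nonneg_left ?_ (hc i hi)
    refine (norm_iteratedFDeriv_apply_le (hCg _ (ell_one_le k i)) _).trans ?_
    exact mul_le_mul_of_nonneg_left (prod_le_Pmax _ ha k Finset.univ
      (fun j : Fin (ell k i 1) => ell k i (j + 2)) (fun j _ => one_le_ell_add_two k i j)
      (sum_ell_le k i)) hC0

theorem Cone_nonneg {c : ℕ → (ℕ → ℕ) → ℝ} {C0 : ℝ} (hC0 : 0 ≤ C0) {k : ℕ}
    (hc : ∀ i, IsBranch k i → 0 ≤ c k i) : 0 ≤ Cone c C0 k := by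
  unfold Cone
  split_ifs
  · exact hC0
  · exact mul_nonneg (finsum_nonneg fun i => finsum_nonneg fun hi => hc i hi) hC0

theorem ell_le_of_mem_Icc {N : ℕ} {i : ℕ → ℕ} {r : ℕ} (hr : r ∈ Finset.Icc 2 (alpha N i)) :
    ell N i r ≤ N := by
  rw [Finset.mem_Icc, alpha] at hr
  obtain ⟨j, rfl⟩ := Nat.exists_eq_add_of_le' hr.1
  exact (Finset.single_le_sum (f := fun j : Fin (ell N i 1) => ell N i (j + 2))
    (fun _ _ => Nat.zero_le _) (Finset.mem_univ ⟨j, by omega⟩)).trans (sum_ell_le N i)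

theorem norm_iteratedFDeriv_replace_le {m N : ℕ} {i : ℕ → ℕ} (f : (Fin m → ℝ) → ℝ)
    (ξ : ℕ → Fin m → ℝ) (y : Fin m → ℝ) {C0 : ℝ} (hC0 : 0 ≤ C0)
    (hCf : ‖iteratedFDeriv ℝ (ell N i 1) f y‖ ≤ C0) {r : ℕ}
    (hr : r ∈ Finset.Icc 2 (alpha N i)) {k : ℕ} (hk : k ≤ ell N i r) (w : Fin m → ℝ) {B : ℝ}
    (hB : 0 ≤ B) (hw : ‖w‖ ≤ B * Pmax (fun q => ‖ξ q‖) k) :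
    ‖iteratedFDeriv ℝ (ell N i 1) f y
      (fun j : Fin (ell N i 1) => if (j : ℕ) + 2 = r then w else ξ (ell N i ((j : ℕ) + 2)))‖
      ≤ C0 * (B * Pmax (fun q => ‖ξ q‖) N) := by
  rw [Finset.mem_Icc, alpha] at hr
  obtain ⟨n, rfl⟩ := Nat.exists_eq_add_of_le' hr.1
  refine (norm_iteratedFDeriv_apply_le hCf _).trans (mul_le_mul_of_nonneg_left ?_ hC0)
  let j₀ : Fin (ell N i 1) := ⟨n, by omega⟩
  have hsum := sum_ell_le N i
  rw [← Finset.sum_erase_add _ _ (Finset.mem_univ j₀)] at hsum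
  rw [← Finset.prod_erase_mul _ _ (Finset.mem_univ j₀)]
  have hprod : ∏ j ∈ Finset.univ.erase j₀,
      ‖if (j : ℕ) + 2 = n + 2 then w else ξ (ell N i ((j : ℕ) + 2))‖ =
      ∏ j ∈ Finset.univ.erase j₀, ‖ξ (ell N i ((j : ℕ) + 2))‖ := by
    refine Finset.prod_congr rfl fun j hj => ?_
    rw [if_neg]
    intro h
    exact (Finset.mem_erase.1 hj).1 (Fin.ext (Nat.add_right_cancel h))
  rw [hprod, if_pos rfl]
  calc _ ≤ (∏ j ∈ Finset.univ.erase j₀, ‖ξ (ell N i ((j : ℕ) + 2))‖) *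
        (B * Pmax (fun q => ‖ξ q‖) k) :=
        mul_le_mul_of_nonneg_left hw (Finset.prod_nonneg fun _ _ => norm_nonneg _)
    _ = B * ((∏ j ∈ Finset.univ.erase j₀, ‖ξ (ell N i ((j : ℕ) + 2))‖) *
        Pmax (fun q => ‖ξ q‖) k) := by ring
    _ ≤ _ := mul_le_mul_of_nonneg_left (prod_mul_Pmax_le (fun q => ‖ξ q‖)
        (fun _ => norm_nonneg _) k N _ (fun j : Fin (ell N i 1) => ell N i (j + 2))
        (fun j _ => one_le_ell_add_two N i j) (le_trans (Nat.add_le_add_left hk _) hsum)) hB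

theorem norm_iteratedFDeriv_snoc_le {m N : ℕ} {i : ℕ → ℕ} (f : (Fin m → ℝ) → ℝ)
    (ξ : ℕ → Fin m → ℝ) (y : Fin m → ℝ) {C0 : ℝ} (hC0 : 0 ≤ C0)
    (hCf : ‖iteratedFDeriv ℝ (ell N i 1 + 1) f y‖ ≤ C0) (w : Fin m → ℝ) (hw : ‖w‖ ≤ C0) :
    ‖iteratedFDeriv ℝ (ell N i 1 + 1) f y (fun j : Fin (ell N i 1 + 1) =>
        if (j : ℕ) < ell N i 1 then ξ (ell N i ((j : ℕ) + 2)) else w)‖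
      ≤ C0 * (C0 * Pmax (fun q => ‖ξ q‖) N) := by
  refine (norm_iteratedFDeriv_apply_le hCf _).trans (mul_le_mul_of_nonneg_left ?_ hC0)
  rw [Fin.prod_univ_castSucc, mul_comm]
  simp only [Fin.val_castSucc, Fin.is_lt, if_true, Fin.val_last, lt_irrefl, if_false]
  exact mul_le_mul hw (prod_le_Pmax (fun q => ‖ξ q‖) (fun _ => norm_nonneg _) N Finset.univ
    (fun j : Fin (ell N i 1) => ell N i (j + 2)) (fun j _ => one_le_ell_add_two N i j)
    (sum_ell_le N i)) (Finset.prod_nonneg fun _ _ => norm_nonneg _) hC0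

/-- **Bounds (4.11) and (4.12) of Lemma 4.6 on the tree operators `ℒ̄^L` and `ℒ̃^L`.**
With `a_ℓ = ‖ξ^ℓ‖` and `P^ℓ = P^ℓ(a)`: `|ℒ̄^L(∂f·g)(y)| ≤ C²_L·P^L` where
`C²_L = ∑_{i ∈ A_L} c_{L,i}·C⁰·(C⁰ + ∑_{r=2}^{α_i} C^1_{ℓ_r^i})`, and
`|ℒ̃^L(∂f·g)(y)| ≤ C³_L·P^L` where
`C³_L = ∑_{i ∈ A_L} ∑_{r=2}^{α_i} c_{L,i}·C⁰·C^1_{ℓ_r^i − 1}`. -/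
theorem tree_operator_bar_tilde_bounds
    (L m : ℕ) (hL : 1 ≤ L) (hm : 1 ≤ m)
    (f : (Fin m → ℝ) → ℝ) (g : (Fin m → ℝ) → Fin m → ℝ) (C0 : ℝ)
    (hf : ContDiff ℝ (L + 1) f) (hg : ContDiff ℝ (L + 1) g)
    (hCf : ∀ τ : ℕ, τ ≤ L + 1 → ∀ y, ‖iteratedFDeriv ℝ τ f y‖ ≤ C0)
    (hCg : ∀ τ : ℕ, τ ≤ L + 1 → ∀ y, ‖iteratedFDeriv ℝ τ g y‖ ≤ C0)
    (c : ℕ → (ℕ → ℕ) → ℝ) (hc : ∀ ℓ ≤ L, ∀ i, IsBranch ℓ i → 0 ≤ c ℓ i)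
    (y : Fin m → ℝ) (ξ : ℕ → Fin m → ℝ) :
    |barL m c f g ξ y L| ≤
      (∑ᶠ i ∈ {i : ℕ → ℕ | IsBranch L i},
        c L i * C0 * (C0 + ∑ r ∈ Finset.Icc 2 (alpha L i), Cone c C0 (ell L i r))) *
        Pmax (fun q => ‖ξ q‖) L ∧
    |tildeL m c f g ξ y L| ≤
      (∑ᶠ i ∈ {i : ℕ → ℕ | IsBranch L i},
        ∑ r ∈ Finset.Icc 2 (alpha L i), c L i * C0 * Cone c C0 (ell L i r - 1)) *
        Pmax (fun q => ‖ξ q‖) L := by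
  have hC0 : 0 ≤ C0 := (norm_nonneg _).trans (hCf 0 (Nat.zero_le _) y)
  have hreplace : ∀ i, IsBranch L i → ∀ r ∈ Finset.Icc 2 (alpha L i), ∀ k ≤ ell L i r,
      ‖c L i * iteratedFDeriv ℝ (ell L i 1) f y (fun j : Fin (ell L i 1) =>
          if (j : ℕ) + 2 = r then Lop m c g ξ y k else ξ (ell L i ((j : ℕ) + 2)))‖ ≤
        c L i * C0 * Cone c C0 k * Pmax (fun q => ‖ξ q‖) L := by
    intro i hi r hr k hk
    have hkL : k ≤ L := hk.trans (ell_le_of_mem_Icc hr)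
    rw [norm_mul, Real.norm_of_nonneg (hc L le_rfl i hi), mul_assoc, mul_assoc]
    exact mul_le_mul_of_nonneg_left (norm_iteratedFDeriv_replace_le f ξ y hC0
      (hCf _ ((ell_one_le L i).trans (Nat.le_succ L)) y) hr hk _ (Cone_nonneg hC0 (hc k hkL))
      (norm_Lop_le c g ξ y C0 k (fun τ hτ => hCg τ (by omega) y) (hc k hkL)))
      (hc L le_rfl i hi)
  have hS := finite_setOf_isBranch L
  simp only [← Real.norm_eq_abs]
  constructor
  · rw [barL, ← finsum_mem_add_distrib hS]
    refine norm_finsum_mem_le_mul hS _ _ _ fun i hi => ?_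
    rw [mul_add, add_mul, Finset.mul_sum, Finset.sum_mul]
    refine norm_add_le_of_le ?_ (norm_sum_le_of_le _ fun r hr => hreplace i hi r hr _ le_rfl)
    rw [norm_mul, Real.norm_of_nonneg (hc L le_rfl i hi), mul_assoc, mul_assoc]
    refine mul_le_mul_of_nonneg_left (norm_iteratedFDeriv_snoc_le f ξ y hC0
      (hCf _ (Nat.succ_le_succ (ell_one_le L i)) y) _ ?_) (hc L le_rfl i hi)
    simpa using hCg 0 (Nat.zero_le _) y
  · rw [tildeL]
    refine norm_finsum_mem_le_mul hS _ _ _ fun i hi => ?_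
    rw [Finset.sum_mul]
    exact norm_sum_le_of_le _ fun r hr => hreplace i hi r hr _ (Nat.sub_le _ _)
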